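/- Let f: A → B be a G-equivariant homomorphism of commutative rings with G a finite group, let q̃ ∈ Spec(B^G) with image q ∈ Spec(A^G). Then f induces an injective ring homomorphism A(q) → B(q̃) between the reduced fibers, and if B is a localisation of a quotient of A, this homomorphism is bijective. -/

import Mathlib

open scoped TensorProduct
set_option synthInstance.maxHeartbeats 400000
set_option maxHeartbeats 1000000

/-- The subring `A^G` of `G`-invariant elements of `A`. -/
def fixedSubring (G A : Type*) [Group G] [CommRing A] [MulSemiringAction G A] : Subring A where
  carrier := {a | ∀ g : G, g • a = a}
  zero_mem' := by intro g; simp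
  one_mem' := by intro g; simp
  add_mem' := by intro a b ha hb g; rw [smul_add, ha g, hb g]
  mul_mem' := by intro a b ha hb g; rw [smul_mul', ha g, hb g]
  neg_mem' := by intro a ha g; rw [smul_neg, ha g]

open MulSemiringAction Polynomial in
/-- If the non-leading coefficients of the characteristic polynomial of `a` come from elements of
the base ring vanishing in `K`, then `a ⊗ 1` is nilpotent. -/
theorem isNilpotent_tmul_one_of_coeff_charpoly {R A K G : Type*} [CommRing R] [CommRing A]
    [Algebra R A] [Group G] [Fintype G] [MulSemiringAction G A] [CommRing K] [Algebra R K] (a : A)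
    (h : ∀ i < Fintype.card G, ∃ r : R,
      algebraMap R A r = (charpoly G a).coeff i ∧ algebraMap R K r = 0) :
    IsNilpotent (a ⊗ₜ[R] (1 : K)) := by
  nontriviality A
  have hdeg : (charpoly G a).natDegree = Fintype.card G := by
    rw [charpoly_eq, natDegree_prod_of_monic _ _ fun g _ ↦ monic_X_sub_C _]
    simp
  have hev := eval_charpoly G a
  have hlead := (monic_charpoly G a).coeff_natDegree
  rw [eval_eq_sum_range, Finset.sum_range_succ, hlead, hdeg, one_mul] at hev
  have hev' := congrArg (Algebra.TensorProduct.includeLeft : A →ₐ[R] TensorProduct R A K) hev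
  rw [map_add, map_sum, Finset.sum_eq_zero, zero_add, map_zero, map_pow] at hev'
  · exact ⟨_, hev'⟩
  · intro i hi
    obtain ⟨r, hr, hr'⟩ := h i (Finset.mem_range.mp hi)
    rw [← hr, map_mul, AlgHom.commutes, Algebra.TensorProduct.algebraMap_apply',
      hr', TensorProduct.tmul_zero, zero_mul]

section ResidueField

variable {R K : Type*} [CommRing R] (q : Ideal R) [q.IsPrime] [Field K] [Algebra R K]
  [Algebra (R ⧸ q) K] [IsScalarTower R (R ⧸ q) K] [IsFractionRing (R ⧸ q) K]

include q

omit [q.IsPrime] in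
theorem algebraMap_residueField_eq_zero_iff (r : R) : algebraMap R K r = 0 ↔ r ∈ q := by
  rw [IsScalarTower.algebraMap_apply R (R ⧸ q) K,
    map_eq_zero_iff _ (IsFractionRing.injective (R ⧸ q) K), Ideal.Quotient.algebraMap_eq,
    Ideal.Quotient.eq_zero_iff_mem]

theorem exists_mul_algebraMap_residueField_eq (x : K) :
    ∃ r s : R, algebraMap R K s ≠ 0 ∧ x * algebraMap R K s = algebraMap R K r := by
  obtain ⟨r, s, hs, rfl⟩ := IsFractionRing.div_surjective (A := R ⧸ q) x
  obtain ⟨r, rfl⟩ := Ideal.Quotient.mk_surjective r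
  obtain ⟨s, rfl⟩ := Ideal.Quotient.mk_surjective s
  have hs' : algebraMap R K s ≠ 0 := by
    rw [Ne, algebraMap_residueField_eq_zero_iff q, ← Ideal.Quotient.eq_zero_iff_mem]
    exact nonZeroDivisors.ne_zero hs
  refine ⟨r, s, hs', ?_⟩
  rw [IsScalarTower.algebraMap_apply R (R ⧸ q) K s] at hs' ⊢
  rw [IsScalarTower.algebraMap_apply R (R ⧸ q) K r]
  exact div_mul_cancel₀ _ hs'

theorem exists_residueField_lift {L : Type*} [Field L] (φ : R →+* L) (hφ : RingHom.ker φ = q) :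
    ∃ ψ : K →+* L, ψ.comp (algebraMap R K) = φ := by
  subst hφ
  refine ⟨IsFractionRing.lift (A := R ⧸ RingHom.ker φ) (g := RingHom.kerLift φ)
    (RingHom.kerLift_injective φ), ?_⟩
  ext r
  rw [RingHom.comp_apply, IsScalarTower.algebraMap_apply R (R ⧸ RingHom.ker φ) K,
    IsFractionRing.lift_algebraMap]
  rfl

/-- Up to a nonzero scalar, every element of the fiber comes from `A`. -/
theorem exists_mul_tmul_algebraMap_eq {A : Type*} [CommRing A] [Algebra R A]
    (x : TensorProduct R A K) :
    ∃ (a : A) (s : R), algebraMap R K s ≠ 0 ∧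
      x * (1 ⊗ₜ[R] algebraMap R K s) = a ⊗ₜ[R] (1 : K) := by
  induction x with
  | zero => exact ⟨0, 1, by simp, by simp⟩
  | tmul a c =>
    obtain ⟨r, s, hs, h⟩ := exists_mul_algebraMap_residueField_eq q c
    refine ⟨r • a, s, hs, ?_⟩
    rw [Algebra.TensorProduct.tmul_mul_tmul, mul_one, h, TensorProduct.smul_tmul,
      Algebra.algebraMap_eq_smul_one]
  | add x y hx hy =>
    obtain ⟨a, s, hs, hx⟩ := hx
    obtain ⟨b, t, ht, hy⟩ := hy
    refine ⟨t • a + s • b, s * t, by simp [hs, ht], ?_⟩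
    have h (u : R) (a : A) : a ⊗ₜ[R] (1 : K) * (1 ⊗ₜ[R] algebraMap R K u) = (u • a) ⊗ₜ[R] 1 := by
      rw [Algebra.TensorProduct.tmul_mul_tmul, mul_one, one_mul, TensorProduct.smul_tmul,
        Algebra.algebraMap_eq_smul_one]
    have hst : (1 : A) ⊗ₜ[R] algebraMap R K (s * t) =
        (1 ⊗ₜ[R] algebraMap R K s) * (1 ⊗ₜ[R] algebraMap R K t) := by
      rw [Algebra.TensorProduct.tmul_mul_tmul, one_mul, map_mul]
    rw [TensorProduct.add_tmul, ← h, ← h, ← hx, ← hy, hst]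
    ring

open MulSemiringAction Polynomial in
/-- If `a ⊗ 1` is nilpotent in the fiber over `q`, then the non-leading coefficients of the
characteristic polynomial of `a` lie in `q`. -/
theorem mem_of_isNilpotent_tmul_one {A G : Type*} [CommRing A] [Algebra R A] [FaithfulSMul R A]
    [Algebra.IsIntegral R A] [Group G] [Fintype G] [MulSemiringAction G A] [SMulCommClass G R A]
    {a : A} (ha : IsNilpotent (a ⊗ₜ[R] (1 : K))) {i : ℕ} (hi : i < Fintype.card G) {r : R}
    (hr : algebraMap R A r = (charpoly G a).coeff i) : r ∈ q := by
  obtain ⟨P, hP, hPq⟩ := Ideal.nonempty_primesOver (S := A) q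
  rw [Ideal.liesOver_iff] at hPq
  let F := FractionRing (A ⧸ P)
  have hF (x : A) : algebraMap (A ⧸ P) F (Ideal.Quotient.mk P x) = 0 ↔ x ∈ P := by
    rw [map_eq_zero_iff _ (IsFractionRing.injective (A ⧸ P) F), Ideal.Quotient.eq_zero_iff_mem]
  have hker (x : R) : algebraMap R F x = 0 ↔ x ∈ q := by
    rw [IsScalarTower.algebraMap_apply R (A ⧸ P) F, IsScalarTower.algebraMap_apply R A (A ⧸ P),
      Ideal.Quotient.algebraMap_eq, hF, hPq, Ideal.mem_comap]
  obtain ⟨ψ, hψ⟩ := exists_residueField_lift (K := K) q (algebraMap R F)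
    (Ideal.ext fun x ↦ by rw [RingHom.mem_ker, hker])
  let ψ' : K →ₐ[R] F := ⟨ψ, fun r ↦ RingHom.congr_fun hψ r⟩
  let π : A →ₐ[R] F := (IsScalarTower.toAlgHom R (A ⧸ P) F).comp (Ideal.Quotient.mkₐ R P)
  have hmem (g : G) : π (g • a) = 0 := by
    let χ : TensorProduct R A K →ₐ[R] F :=
      Algebra.TensorProduct.lift (π.comp (MulSemiringAction.toAlgHom R A g)) ψ'
        fun _ _ ↦ Commute.all _ _
    have h : χ (a ⊗ₜ 1) = π (g • a) := by simp [χ]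
    rw [← h]
    exact (ha.map χ).eq_zero
  have hpoly : (charpoly G a).map (π : A →+* F) = X ^ Fintype.card G := by
    rw [charpoly_eq, Polynomial.map_prod]
    simp [hmem]
  rw [← hker, ← π.commutes, hr, ← RingHom.coe_coe, ← coeff_map, hpoly, coeff_X_pow, if_neg hi.ne]

end ResidueField

/-- In a quotient of a fiber of an integral extension, the non-zero-divisors are units. -/
theorem isUnit_of_mem_nonZeroDivisors_fiber {R A K : Type*} [CommRing R] [CommRing A]
    [Algebra R A] [Algebra.IsIntegral R A] [Field K] [Algebra R K]
    (I : Ideal (TensorProduct R A K)) {x : TensorProduct R A K ⧸ I}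
    (hx : x ∈ nonZeroDivisors (TensorProduct R A K ⧸ I)) : IsUnit x := by
  let : Algebra K (TensorProduct R A K) := Algebra.TensorProduct.rightAlgebra
  obtain ⟨y, rfl⟩ := Ideal.Quotient.mk_surjective x
  refine IsArtinianRing.isUnit_of_isIntegral_of_nonZeroDivisor (R := K) ?_ hx
  have hy : IsIntegral K y := by
    clear hx
    induction y with
    | zero => exact isIntegral_zero
    | add x y hx hy => exact hx.add hy
    | tmul a c =>
      have ha : IsIntegral K (a ⊗ₜ[R] (1 : K)) :=
        ((Algebra.IsIntegral.isIntegral (R := R) a).map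
          (Algebra.TensorProduct.includeLeft : A →ₐ[R] TensorProduct R A K)).tower_top
      have hc : IsIntegral K ((1 : A) ⊗ₜ[R] c) :=
        isIntegral_algebraMap (A := TensorProduct R A K) (x := c)
      simpa using ha.mul hc
  exact hy.map (Ideal.Quotient.mkₐ K I)

section FixedSubring

variable (G A : Type*) [Group G] [CommRing A] [MulSemiringAction G A]

instance : Algebra.IsInvariant (fixedSubring G A) A G :=
  ⟨fun b hb ↦ ⟨⟨b, hb⟩, rfl⟩⟩

instance : SMulCommClass G (fixedSubring G A) A :=
  ⟨fun g r a ↦ by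
    change g • ((r : A) * a) = (r : A) * g • a
    rw [smul_mul', r.2 g]⟩

instance [Finite G] : Algebra.IsIntegral (fixedSubring G A) A :=
  Algebra.IsInvariant.isIntegral _ _ G

end FixedSubring

open MulSemiringAction in
theorem map_charpoly_of_equivariant {G A B : Type*} [Group G] [Fintype G] [CommRing A]
    [CommRing B] [MulSemiringAction G A] [MulSemiringAction G B] (f : A →+* B)
    (hf : ∀ (g : G) (a : A), f (g • a) = g • f a) (a : A) :
    (charpoly G a).map f = charpoly G (f a) := by
  simp [charpoly_eq, Polynomial.map_prod, hf]

/-- Every element of a localisation of a quotient of `A` is a fraction of elements of `A`. -/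
theorem exists_isUnit_mul_eq_of_localization_quotient {A B : Type*} [CommRing A] [CommRing B]
    (f : A →+* B)
    (h : ∃ (I : Ideal A) (M : Submonoid (A ⧸ I)) (e : B ≃+* Localization M),
      ∀ a : A, e (f a) = algebraMap (A ⧸ I) (Localization M) (Ideal.Quotient.mk I a)) (b : B) :
    ∃ a m : A, IsUnit (f m) ∧ b * f m = f a := by
  obtain ⟨I, M, e, he⟩ := h
  obtain ⟨⟨a, m⟩, hm⟩ := IsLocalization.surj M (e b)
  obtain ⟨a, rfl⟩ := Ideal.Quotient.mk_surjective a
  obtain ⟨n, hn⟩ := Ideal.Quotient.mk_surjective m.1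
  refine ⟨a, n, ?_, e.injective ?_⟩
  · rw [← MulEquiv.isUnit_map e, he, hn]
    exact IsLocalization.map_units _ m
  · rw [map_mul, he, he, hn]
    exact hm

/-- Let `f : A → B` be a `G`-equivariant homomorphism of commutative rings,
with `G` a finite group, and let `q̃ ∈ Spec (B^G)` with image `q ∈ Spec (A^G)`.  Then `f`
induces an injective ring homomorphism `A(q) → B(q̃)` between the reduced fibers, and if `B`
is a localisation of a quotient of `A`, this homomorphism is bijective. -/
theorem reduced_fiber_map_injective (G A B : Type*) [Group G] [Finite G] [CommRing A]
    [CommRing B] [MulSemiringAction G A] [MulSemiringAction G B]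
    (f : A →+* B) (hfG : ∀ (g : G) (a : A), f (g • a) = g • f a)
    (fres : fixedSubring G A →+* fixedSubring G B) (hfres : ∀ a, (fres a : B) = f a)
    (q' : Ideal (fixedSubring G B)) [q'.IsPrime]
    (q : Ideal (fixedSubring G A)) (hq : q = q'.comap fres) [q.IsPrime]
    (kq : Type*) [Field kq] [Algebra ((fixedSubring G A) ⧸ q) kq]
    [IsFractionRing ((fixedSubring G A) ⧸ q) kq]
    (kq' : Type*) [Field kq'] [Algebra ((fixedSubring G B) ⧸ q') kq']
    [IsFractionRing ((fixedSubring G B) ⧸ q') kq'] :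
    letI : Algebra (fixedSubring G A) kq :=
      ((algebraMap ((fixedSubring G A) ⧸ q) kq).comp (Ideal.Quotient.mk q)).toAlgebra
    letI : Algebra (fixedSubring G B) kq' :=
      ((algebraMap ((fixedSubring G B) ⧸ q') kq').comp (Ideal.Quotient.mk q')).toAlgebra
    ∃ φ : (TensorProduct (fixedSubring G A) A kq ⧸
            nilradical (TensorProduct (fixedSubring G A) A kq)) →+*
          (TensorProduct (fixedSubring G B) B kq' ⧸
            nilradical (TensorProduct (fixedSubring G B) B kq')),
      (∀ a : A,
          φ (Ideal.Quotient.mk (nilradical (TensorProduct (fixedSubring G A) A kq))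
              (a ⊗ₜ[fixedSubring G A] (1 : kq))) =
            Ideal.Quotient.mk (nilradical (TensorProduct (fixedSubring G B) B kq'))
              (f a ⊗ₜ[fixedSubring G B] (1 : kq'))) ∧
      Function.Injective φ ∧
      ((∃ (I : Ideal A) (M : Submonoid (A ⧸ I)) (e : B ≃+* Localization M),
          ∀ a : A, e (f a) = algebraMap (A ⧸ I) (Localization M) (Ideal.Quotient.mk I a)) →
        Function.Bijective φ) := by
  let iA : Algebra (fixedSubring G A) kq :=
    ((algebraMap ((fixedSubring G A) ⧸ q) kq).comp (Ideal.Quotient.mk q)).toAlgebra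
  let iB : Algebra (fixedSubring G B) kq' :=
    ((algebraMap ((fixedSubring G B) ⧸ q') kq').comp (Ideal.Quotient.mk q')).toAlgebra
  have : IsScalarTower (fixedSubring G A) ((fixedSubring G A) ⧸ q) kq :=
    IsScalarTower.of_algebraMap_eq (R := fixedSubring G A) (S := fixedSubring G A ⧸ q) (A := kq)
      fun _ ↦ rfl
  have : IsScalarTower (fixedSubring G B) ((fixedSubring G B) ⧸ q') kq' :=
    IsScalarTower.of_algebraMap_eq (R := fixedSubring G B) (S := fixedSubring G B ⧸ q') (A := kq')
      fun _ ↦ rfl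
  cases nonempty_fintype G
  obtain ⟨k, hk⟩ := exists_residueField_lift (K := kq) q
    ((algebraMap (fixedSubring G B) kq').comp fres) (by
      ext r
      rw [RingHom.mem_ker, RingHom.comp_apply, algebraMap_residueField_eq_zero_iff q', hq,
        Ideal.mem_comap])
  let ψ : TensorProduct (fixedSubring G A) A kq →+* TensorProduct (fixedSubring G B) B kq' :=
    Algebra.TensorProduct.mapRingHom fres f k (by ext r; exact (hfres r).symm) hk
  have hψ (a : A) (c : kq) : ψ (a ⊗ₜ c) = f a ⊗ₜ k c := Algebra.TensorProduct.mapRingHom_tmul ..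
  let φ := Ideal.quotientMap (nilradical (TensorProduct (fixedSubring G B) B kq'))
    (I := nilradical (TensorProduct (fixedSubring G A) A kq)) ψ fun x hx ↦ IsNilpotent.map hx ψ
  have hφ (a : A) : φ (Ideal.Quotient.mk _ (a ⊗ₜ[fixedSubring G A] (1 : kq))) =
      Ideal.Quotient.mk _ (f a ⊗ₜ[fixedSubring G B] (1 : kq')) := by
    rw [← map_one k, ← hψ]
    exact Ideal.quotientMap_mk ..
  have hinj : Function.Injective φ := by
    refine Ideal.quotientMap_injective' fun x hx ↦ ?_
    obtain ⟨a, s, hs, hxa⟩ := exists_mul_tmul_algebraMap_eq q x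
    have hu : IsUnit ((1 : A) ⊗ₜ[fixedSubring G A] algebraMap (fixedSubring G A) kq s) :=
      hs.isUnit.map Algebra.TensorProduct.includeRight
    have hfa : IsNilpotent (f a ⊗ₜ[fixedSubring G B] (1 : kq')) := by
      rw [← map_one k, ← hψ, ← hxa, map_mul]
      exact (Commute.all _ _).isNilpotent_mul_right hx
    have ha : IsNilpotent (a ⊗ₜ[fixedSubring G A] (1 : kq)) := by
      refine isNilpotent_tmul_one_of_coeff_charpoly (G := G) a fun i hi ↦ ?_
      let r : fixedSubring G A :=
        ⟨(MulSemiringAction.charpoly G a).coeff i, MulSemiringAction.smul_coeff_charpoly a i⟩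
      refine ⟨r, rfl, ?_⟩
      rw [algebraMap_residueField_eq_zero_iff q, hq, Ideal.mem_comap]
      refine mem_of_isNilpotent_tmul_one q' (G := G) hfa hi ?_
      rw [← map_charpoly_of_equivariant f hfG, Polynomial.coeff_map]
      exact hfres r
    rw [← hxa] at ha
    exact (hu.isNilpotent_mul_unit_of_commute_iff (Commute.all _ _)).mp ha
  refine ⟨φ, hφ, hinj, fun hloc ↦ ⟨hinj, ?_⟩⟩
  have hunit (y) (hy : IsUnit (φ y)) : IsUnit y :=
    isUnit_of_mem_nonZeroDivisors_fiber _
      (comap_nonZeroDivisors_le_of_injective hinj hy.mem_nonZeroDivisors)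
  have hdiv {z y w} (hy : IsUnit (φ y)) (h : z * φ y = φ w) : z ∈ φ.range := by
    obtain ⟨v, hv⟩ := (hunit y hy).exists_right_inv
    exact ⟨w * v, by rw [map_mul, ← h, mul_assoc, ← map_mul, hv, map_one, mul_one]⟩
  have hB (b : B) : Ideal.Quotient.mk _ (b ⊗ₜ[fixedSubring G B] (1 : kq')) ∈ φ.range := by
    obtain ⟨a, m, hm, hb⟩ := exists_isUnit_mul_eq_of_localization_quotient f hloc b
    refine hdiv (y := Ideal.Quotient.mk _ (m ⊗ₜ 1)) (w := Ideal.Quotient.mk _ (a ⊗ₜ 1)) ?_ ?_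
    · rw [hφ]
      exact (hm.map (Algebra.TensorProduct.includeLeft :
        B →ₐ[fixedSubring G B] TensorProduct (fixedSubring G B) B kq')).map _
    · rw [hφ, hφ, ← map_mul, Algebra.TensorProduct.tmul_mul_tmul, hb, mul_one]
  intro z
  obtain ⟨x, rfl⟩ := Ideal.Quotient.mk_surjective z
  obtain ⟨b, s, hs, hx⟩ := exists_mul_tmul_algebraMap_eq q' x
  obtain ⟨w, hw⟩ := hB b
  obtain ⟨y, hy⟩ := hB (s : B)
  have hsy : φ y = Ideal.Quotient.mk _ (1 ⊗ₜ algebraMap (fixedSubring G B) kq' s) := by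
    rw [hy, Algebra.algebraMap_eq_smul_one, ← TensorProduct.smul_tmul, Algebra.smul_def, mul_one]
    rfl
  refine hdiv (y := y) (w := w) ?_ ?_
  · rw [hsy]
    exact (hs.isUnit.map (Algebra.TensorProduct.includeRight :
      kq' →ₐ[fixedSubring G B] TensorProduct (fixedSubring G B) B kq')).map _
  · rw [hsy, hw, ← map_mul, hx]
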